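/- arXiv:1003.4592 — 2 statements merged into one kernel-verified Lean document; each statement's English description precedes it below -/
import Mathlib

section
/- If ζ(3) is irrational, then the real number 4 ∑_{n=1}^∞ 1/(n(16n² − 1)³) − 12 log 2 − 5G is irrational, where G is Catalan's constant. -/
/-- Catalan's constant `G = ∑_{j=0}^∞ (−1)^j/(2j+1)²`. -/
noncomputable def catalan' : ℝ := ∑' j : ℕ, (-1) ^ j / (2 * (j : ℝ) + 1) ^ 2

open Filter Topology Finset

/-- Partial fraction decomposition of the partial sums of `∑ 4 / (n (16 n² - 1)³)`. -/
lemma sum_range_four_div_eq (N : ℕ) :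
    ∑ k ∈ range N, 4 * (1 / (((k : ℝ) + 1) * (16 * ((k : ℝ) + 1) ^ 2 - 1) ^ 3)) =
      8 * (∑ i ∈ range (4 * N + 1), 1 / ((i : ℝ) + 1) -
          (∑ i ∈ range (2 * N), 1 / ((i : ℝ) + 1)) / 2 -
          (∑ i ∈ range N, 1 / ((i : ℝ) + 1)) / 2 - 1) +
        5 * (∑ j ∈ range (2 * N + 1), (-1) ^ j / (2 * (j : ℝ) + 1) ^ 2 - 1) +
        2 * (∑ i ∈ range (4 * N + 1), 1 / ((i : ℝ) + 1) ^ 3 -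
          (∑ i ∈ range (2 * N), 1 / ((i : ℝ) + 1) ^ 3) / 8 - 1) := by
  induction N with
  | zero => norm_num
  | succ N ih =>
    have h4 : 4 * (N + 1) + 1 = 4 * N + 1 + 1 + 1 + 1 + 1 := by ring
    have h2 : 2 * (N + 1) + 1 = 2 * N + 1 + 1 + 1 := by ring
    have h2' : 2 * (N + 1) = 2 * N + 1 + 1 := by ring
    have hs : ((-1 : ℝ)) ^ (2 * N + 1) = -1 := Odd.neg_one_pow ⟨N, rfl⟩
    have hs' : ((-1 : ℝ)) ^ (2 * N + 1 + 1) = 1 := Even.neg_one_pow ⟨N + 1, by ring⟩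
    rw [sum_range_succ, ih, h4, h2, h2']
    simp only [sum_range_succ _ (4 * N + 1), sum_range_succ _ (4 * N + 1 + 1),
      sum_range_succ _ (4 * N + 1 + 1 + 1), sum_range_succ _ (4 * N + 1 + 1 + 1 + 1),
      sum_range_succ _ (2 * N + 1 + 1), sum_range_succ _ (2 * N + 1), sum_range_succ _ (2 * N),
      sum_range_succ _ N, hs, hs']
    push_cast
    have hx : (0 : ℝ) ≤ N := Nat.cast_nonneg N
    generalize (N : ℝ) = x at hx ⊢
    rw [show 16 * (x + 1) ^ 2 - 1 = (4 * x + 3) * (4 * x + 5) by ring,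
      show 4 * x + 1 + 1 = 2 * (2 * x + 1) by ring,
      show 2 * (2 * x + 1) + 1 = 4 * x + 3 by ring,
      show 4 * x + 3 + 1 = 4 * (x + 1) by ring,
      show 4 * (x + 1) + 1 = 4 * x + 5 by ring,
      show 2 * x + 1 + 1 = 2 * (x + 1) by ring,
      show 2 * (2 * (x + 1)) + 1 = 4 * x + 5 by ring]
    have h1 : x + 1 ≠ 0 := by positivity
    have h2 : 2 * x + 1 ≠ 0 := by positivity
    have h3 : 4 * x + 3 ≠ 0 := by positivity
    have h5 : 4 * x + 5 ≠ 0 := by positivity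
    have key : 4 * (1 / ((x + 1) * ((4 * x + 3) * (4 * x + 5)) ^ 3)) =
        8 * (1 / (4 * x + 3) + 1 / (4 * x + 5) - 1 / (2 * (x + 1))) -
          5 * (1 / (4 * x + 3) ^ 2 - 1 / (4 * x + 5) ^ 2) +
          2 * (1 / (4 * x + 3) ^ 3 + 1 / (4 * x + 5) ^ 3) := by
      field_simp
      ring
    rw [key]
    field_simp
    ring

lemma tendsto_sum_range_one_div_sub_log :
    Tendsto (fun N : ℕ => ∑ i ∈ range N, 1 / ((i : ℝ) + 1) - Real.log N) atTop
      (𝓝 Real.eulerMascheroniConstant) := by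
  refine Real.tendsto_harmonic_sub_log.congr fun N => ?_
  simp [harmonic]

lemma tendsto_harmonic_combination :
    Tendsto (fun N : ℕ => ∑ i ∈ range (4 * N + 1), 1 / ((i : ℝ) + 1) -
          (∑ i ∈ range (2 * N), 1 / ((i : ℝ) + 1)) / 2 -
          (∑ i ∈ range N, 1 / ((i : ℝ) + 1)) / 2) atTop (𝓝 (3 / 2 * Real.log 2)) := by
  have h := tendsto_sum_range_one_div_sub_log
  have h2 := h.comp (tendsto_id.const_mul_atTop' (show 0 < 2 by norm_num))
  have h4 := h.comp (tendsto_id.const_mul_atTop' (show 0 < 4 by norm_num))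
  have h0 : Tendsto (fun N : ℕ => 1 / (((4 * N : ℕ) : ℝ) + 1)) atTop (𝓝 0) :=
    (tendsto_one_div_add_atTop_nhds_zero_nat (𝕜 := ℝ)).comp
      (tendsto_id.const_mul_atTop' (show 0 < 4 by norm_num))
  have key := ((((h4.add h0).sub (h2.div_const 2)).sub (h.div_const 2)).add_const
    (3 / 2 * Real.log 2))
  rw [add_zero, sub_half, sub_self, zero_add] at key
  refine key.congr' ?_
  filter_upwards [eventually_gt_atTop 0] with N hN
  have hN' : (N : ℝ) ≠ 0 := by positivity
  have l4 : Real.log 4 = 2 * Real.log 2 := by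
    rw [show (4 : ℝ) = 2 ^ 2 by norm_num, Real.log_pow]; norm_num
  simp only [Function.comp_apply, id, sum_range_succ _ (4 * N)]
  push_cast
  rw [Real.log_mul (by norm_num) hN', Real.log_mul (by norm_num) hN', l4]
  ring

lemma summable_catalan : Summable fun j : ℕ => (-1 : ℝ) ^ j / (2 * (j : ℝ) + 1) ^ 2 := by
  refine Summable.of_norm_bounded
    ((summable_nat_add_iff 1).2 (Real.summable_one_div_nat_pow.2 one_lt_two)) fun j => ?_
  rw [norm_div, norm_pow, norm_neg, norm_one, one_pow, Real.norm_of_nonneg (by positivity)]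
  push_cast
  gcongr
  linarith [(Nat.cast_nonneg j : (0 : ℝ) ≤ j)]

lemma four_mul_tsum_eq :
    4 * (∑' n : ℕ+, 1 / ((n : ℝ) * (16 * (n : ℝ) ^ 2 - 1) ^ 3)) =
      12 * Real.log 2 + 5 * catalan' + 7 / 4 * (∑' n : ℕ+, 1 / (n : ℝ) ^ 3) - 15 := by
  rw [← tsum_mul_left,
    tsum_pnat_eq_tsum_succ (f := fun n : ℕ => 4 * (1 / ((n : ℝ) * (16 * (n : ℝ) ^ 2 - 1) ^ 3))),
    tsum_pnat_eq_tsum_succ (f := fun n : ℕ => 1 / (n : ℝ) ^ 3)]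
  push_cast
  refine HasSum.tsum_eq ((hasSum_iff_tendsto_nat_of_nonneg (fun k => ?_) _).2 ?_)
  · have : 0 ≤ 16 * ((k : ℝ) + 1) ^ 2 - 1 := by nlinarith [(Nat.cast_nonneg k : (0 : ℝ) ≤ k)]
    positivity
  have hz : Summable fun k : ℕ => 1 / ((k : ℝ) + 1) ^ 3 := by
    simpa using (summable_nat_add_iff 1).2
      (Real.summable_one_div_nat_pow.2 (show 1 < 3 by norm_num))
  have t1 (c : ℕ) (hc : 0 < c) : Tendsto (fun N : ℕ => c * N) atTop atTop :=
    tendsto_id.const_mul_atTop' hc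
  have t2 (c : ℕ) (hc : 0 < c) : Tendsto (fun N : ℕ => c * N + 1) atTop atTop :=
    (tendsto_add_atTop_nat 1).comp (t1 c hc)
  have z := hz.hasSum.tendsto_sum_nat
  have key := (((tendsto_harmonic_combination.sub_const 1).const_mul 8).add
    (((summable_catalan.hasSum.tendsto_sum_nat.comp (t2 2 two_pos)).sub_const 1).const_mul 5)).add
    ((((z.comp (t2 4 four_pos)).sub ((z.comp (t1 2 two_pos)).div_const 8)).sub_const 1).const_mul 2)
  simp only [Function.comp_apply] at key
  simp only [sum_range_four_div_eq]
  convert key using 2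
  rw [catalan']
  ring

theorem irrational_of_irrational_zeta_three
    (h : Irrational (∑' n : ℕ+, 1 / (n : ℝ) ^ 3)) :
    Irrational (4 * (∑' n : ℕ+, 1 / ((n : ℝ) * (16 * (n : ℝ) ^ 2 - 1) ^ 3)) -
      12 * Real.log 2 - 5 * catalan') := by
  rw [four_mul_tsum_eq]
  have h' := (h.ratCast_mul (q := 7 / 4) (by norm_num)).sub_ratCast 15
  push_cast at h'
  convert h' using 1
  ring
end

section
/- ∑_{n=1}^∞ 1/(n(16n² − 1)⁴) = (ψ⁽³⁾(3/4) − ψ⁽³⁾(1/4))/6144 + (140 − 44G − 96 log 2 − 21ζ(3))/32, where ψ⁽³⁾ is the third derivative of the digamma function, G is Catalan's constant, and ζ(3) = ∑_{n=1}^∞ 1/n³. -/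
/-- The digamma function `ψ(x) = Γ'(x)/Γ(x)`. -/
noncomputable def digamma (x : ℝ) : ℝ := deriv Real.Gamma x / Real.Gamma x

open Filter Topology Set

lemma summable_one_div_add_natCast_pow (x : ℝ) {m : ℕ} (hm : 2 ≤ m) :
    Summable fun k : ℕ ↦ 1 / (x + k) ^ m := by
  have h := (Real.summable_one_div_nat_add_rpow x m).2 (by exact_mod_cast hm)
  refine Summable.of_norm (h.congr fun k ↦ ?_)
  rw [Real.rpow_natCast, norm_div, norm_pow, norm_one, Real.norm_eq_abs, add_comm]

lemma hasDerivAt_one_div_add_natCast_pow (m k : ℕ) {x : ℝ} (hx : 0 < x) :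
    HasDerivAt (fun y : ℝ ↦ 1 / (y + k) ^ m) (-m * (1 / (x + k) ^ (m + 1))) x := by
  have hk : x + k ≠ 0 := by positivity
  have h := (((hasDerivAt_id x).add_const (k : ℝ)).pow m).inv (pow_ne_zero m hk)
  simp only [id, Pi.pow_apply] at h
  convert! h using 1
  · ext y; simp
  · rcases m with _ | m
    · simp
    · simp only [Nat.add_sub_cancel]
      field_simp
      ring

lemma hasDerivAt_tsum_one_div_add_natCast_pow {m : ℕ} (hm : 2 ≤ m) {x : ℝ} (hx : 0 < x) :
    HasDerivAt (fun y : ℝ ↦ ∑' k : ℕ, 1 / (y + k) ^ m)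
      (-m * ∑' k : ℕ, 1 / (x + k) ^ (m + 1)) x := by
  rw [← tsum_mul_left]
  refine hasDerivAt_tsum_of_isPreconnected (t := Ioi (x / 2))
    ((summable_one_div_add_natCast_pow (x / 2) (hm.trans m.le_succ)).mul_left (m : ℝ))
    isOpen_Ioi isPreconnected_Ioi
    (fun k y hy ↦ hasDerivAt_one_div_add_natCast_pow m k ((half_pos hx).trans hy))
    (fun k y hy ↦ ?_) (half_lt_self hx) (summable_one_div_add_natCast_pow x hm) (half_lt_self hx)
  have hy' : x / 2 < y := hy
  have hy0 : 0 < y := (half_pos hx).trans hy'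
  rw [norm_mul, norm_neg, Real.norm_natCast, Real.norm_of_nonneg (by positivity)]
  gcongr

lemma Real.differentiableAt_Gamma_of_pos {x : ℝ} (hx : 0 < x) : DifferentiableAt ℝ Real.Gamma x :=
  Real.differentiableAt_Gamma fun m ↦ by linarith [m.cast_nonneg (α := ℝ)]

lemma digamma_monotoneOn : MonotoneOn digamma (Ioi 0) := by
  have hd {x : ℝ} (hx : 0 < x) : HasDerivAt (Real.log ∘ Real.Gamma) (digamma x) x :=
    (Real.differentiableAt_Gamma_of_pos hx).hasDerivAt.log (Real.Gamma_pos_of_pos hx).ne'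
  exact (Real.convexOn_log_Gamma.monotoneOn_deriv fun x hx ↦ (hd hx).differentiableAt).congr
    fun x hx ↦ (hd hx).deriv

lemma digamma_add_one {x : ℝ} (hx : 0 < x) : digamma (x + 1) = digamma x + 1 / x := by
  have h : deriv Real.Gamma (x + 1) = Real.Gamma x + x * deriv Real.Gamma x := by
    rw [← deriv_comp_add_const]
    have h2 := (hasDerivAt_id x).mul (Real.differentiableAt_Gamma_of_pos hx).hasDerivAt
    simp only [id, one_mul] at h2
    rw [← h2.deriv]
    apply EventuallyEq.deriv_eq
    filter_upwards [eventually_gt_nhds hx] with y hy using Real.Gamma_add_one hy.ne'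
  have hG := (Real.Gamma_pos_of_pos hx).ne'
  rw [digamma, digamma, h, Real.Gamma_add_one hx.ne']
  field_simp
  ring

lemma digamma_add_natCast {x : ℝ} (hx : 0 < x) (n : ℕ) :
    digamma (x + n) = digamma x + ∑ k ∈ Finset.range n, 1 / (x + k) := by
  induction n with
  | zero => simp
  | succ n ih =>
    rw [Finset.sum_range_succ, Nat.cast_succ, ← add_assoc, digamma_add_one (by positivity), ih]
    ring

lemma tendsto_digamma_add_natCast_sub {x y : ℝ} (hx : 0 < x) (hxy : x ≤ y) :
    Tendsto (fun n : ℕ ↦ digamma (y + n) - digamma (x + n)) atTop (𝓝 0) := by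
  obtain ⟨m, hm⟩ := exists_nat_ge (y - x)
  have hlim : Tendsto (fun n : ℕ ↦ ∑ k ∈ Finset.range m, 1 / (x + n + k)) atTop (𝓝 0) := by
    rw [← Finset.sum_const_zero (s := Finset.range m)]
    refine tendsto_finsetSum _ fun k _ ↦ ?_
    simp only [one_div]
    exact tendsto_inv_atTop_zero.comp (tendsto_atTop_add_const_right _ _
      (tendsto_atTop_add_const_left _ _ tendsto_natCast_atTop_atTop))
  refine squeeze_zero (fun n ↦ ?_) (fun n ↦ ?_) hlim
  · refine sub_nonneg.2 (digamma_monotoneOn ?_ ?_ (by linarith)) <;> simp only [mem_Ioi] <;>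
      linarith [n.cast_nonneg (α := ℝ)]
  · rw [sub_le_iff_le_add', ← digamma_add_natCast (by positivity)]
    refine digamma_monotoneOn ?_ ?_ (by linarith) <;> simp only [mem_Ioi] <;>
      linarith [n.cast_nonneg (α := ℝ), m.cast_nonneg (α := ℝ)]

lemma summable_one_div_sub_one_div_add_natCast {x y : ℝ} (hx : 0 < x) (hy : 0 < y) :
    Summable fun k : ℕ ↦ 1 / (x + k) - 1 / (y + k) := by
  have hm : 0 < min x y := lt_min hx hy
  refine Summable.of_norm_bounded
    ((summable_one_div_add_natCast_pow (min x y) le_rfl).mul_left |y - x|) fun k ↦ ?_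
  have h : 1 / (x + k) - 1 / (y + k) = (y - x) * (1 / ((x + k) * (y + k))) := by
    field_simp
    ring
  rw [h, norm_mul, Real.norm_eq_abs, Real.norm_of_nonneg (by positivity), sq]
  gcongr
  · exact min_le_left _ _
  · exact min_le_right _ _

lemma digamma_eq_tsum {x : ℝ} (hx : 0 < x) :
    digamma x = digamma 1 + ∑' k : ℕ, (1 / (1 + (k : ℝ)) - 1 / (x + k)) := by
  have hsum := (summable_one_div_sub_one_div_add_natCast one_pos hx).hasSum.tendsto_sum_nat
  have hlim : Tendsto (fun n : ℕ ↦ digamma (x + n) - digamma (1 + n)) atTop (𝓝 0) := by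
    rcases le_total x 1 with h | h
    · simpa using (tendsto_digamma_add_natCast_sub hx h).neg
    · exact tendsto_digamma_add_natCast_sub one_pos h
  have h := tendsto_nhds_unique (hlim.add hsum)
    (tendsto_const_nhds (x := digamma x - digamma 1) |>.congr fun n ↦ by
      rw [digamma_add_natCast hx, digamma_add_natCast one_pos, Finset.sum_sub_distrib]
      ring)
  linarith

lemma hasDerivAt_digamma {x : ℝ} (hx : 0 < x) :
    HasDerivAt digamma (∑' k : ℕ, 1 / (x + k) ^ 2) x := by
  have h : HasDerivAt (fun y : ℝ ↦ ∑' k : ℕ, (1 / (1 + (k : ℝ)) - 1 / (y + k)))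
      (∑' k : ℕ, 1 / (x + k) ^ 2) x := by
    refine hasDerivAt_tsum_of_isPreconnected (t := Ioi (x / 2))
      (g := fun (k : ℕ) y ↦ 1 / (1 + (k : ℝ)) - 1 / (y + k)) (g' := fun (k : ℕ) y ↦ 1 / (y + k) ^ 2)
      (summable_one_div_add_natCast_pow (x / 2) le_rfl) isOpen_Ioi isPreconnected_Ioi
      (fun k y hy ↦ ?_) (fun k y hy ↦ ?_) (half_lt_self hx)
      (summable_one_div_sub_one_div_add_natCast one_pos hx) (half_lt_self hx)
    · have h := (hasDerivAt_one_div_add_natCast_pow 1 k ((half_pos hx).trans hy)).const_sub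
        (1 / (1 + (k : ℝ)))
      simp only [pow_one, Nat.cast_one, neg_mul, one_mul, neg_neg] at h
      exact h
    · have hy' : x / 2 < y := hy
      have hy0 : 0 < y := (half_pos hx).trans hy'
      rw [Real.norm_of_nonneg (by positivity)]
      gcongr
  refine (h.const_add (digamma 1)).congr_of_eventuallyEq ?_
  filter_upwards [eventually_gt_nhds hx] with y hy using digamma_eq_tsum hy

lemma iteratedDeriv_three_digamma {x : ℝ} (hx : 0 < x) :
    iteratedDeriv 3 digamma x = 6 * ∑' k : ℕ, 1 / (x + k) ^ 4 := by
  have h1 {y : ℝ} (hy : 0 < y) : deriv digamma =ᶠ[𝓝 y] fun z ↦ ∑' k : ℕ, 1 / (z + k) ^ 2 := by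
    filter_upwards [eventually_gt_nhds hy] with z hz using (hasDerivAt_digamma hz).deriv
  have h2 {y : ℝ} (hy : 0 < y) :
      deriv (deriv digamma) =ᶠ[𝓝 y] fun z ↦ -2 * ∑' k : ℕ, 1 / (z + k) ^ 3 := by
    filter_upwards [eventually_gt_nhds hy] with z hz
    rw [(h1 hz).deriv_eq, (hasDerivAt_tsum_one_div_add_natCast_pow le_rfl hz).deriv]
    norm_num
  rw [iteratedDeriv_succ, iteratedDeriv_succ, iteratedDeriv_one, (h2 hx).deriv_eq,
    ((hasDerivAt_tsum_one_div_add_natCast_pow (by norm_num) hx).const_mul (-2)).deriv]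
  push_cast
  ring

lemma iteratedDeriv_three_digamma_div_four {c : ℝ} (hc : 0 < c) :
    iteratedDeriv 3 digamma (c / 4) = 1536 * ∑' k : ℕ, 1 / (4 * (k : ℝ) + c) ^ 4 := by
  rw [iteratedDeriv_three_digamma (by positivity), ← tsum_mul_left, ← tsum_mul_left]
  refine tsum_congr fun k ↦ ?_
  have h : (0 : ℝ) < 4 * k + c := by positivity
  rw [show c / 4 + (k : ℝ) = (4 * k + c) / 4 by ring]
  field_simp
  norm_num

lemma summable_one_div_four_mul_add_pow (c : ℝ) {m : ℕ} (hm : 2 ≤ m) :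
    Summable fun k : ℕ ↦ 1 / (4 * (k : ℝ) + c) ^ m := by
  refine ((summable_one_div_add_natCast_pow (c / 4) hm).mul_left (1 / 4 ^ m)).congr fun k ↦ ?_
  rw [one_div_mul_one_div, ← mul_pow]
  ring_nf

lemma hasSum_one_div_four_mul_add_five_pow {m : ℕ} (hm : 2 ≤ m) :
    HasSum (fun k : ℕ ↦ 1 / (4 * (k : ℝ) + 5) ^ m)
      (∑' k : ℕ, 1 / (4 * (k : ℝ) + 1) ^ m - 1) := by
  have h := (hasSum_nat_add_iff' 1).2 (summable_one_div_four_mul_add_pow 1 hm).hasSum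
  simp only [Finset.sum_range_one, Nat.cast_zero, mul_zero, zero_add, one_pow, div_one] at h
  refine h.congr_fun fun k ↦ ?_
  push_cast
  ring_nf

lemma catalan'_eq :
    catalan' = ∑' k : ℕ, 1 / (4 * (k : ℝ) + 1) ^ 2 - ∑' k : ℕ, 1 / (4 * (k : ℝ) + 3) ^ 2 := by
  rw [sub_eq_add_neg]
  refine (HasSum.even_add_odd (f := fun j : ℕ ↦ (-1) ^ j / (2 * (j : ℝ) + 1) ^ 2) ?_ ?_).tsum_eq
  · convert (summable_one_div_four_mul_add_pow 1 le_rfl).hasSum using 2 with k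
    rw [pow_mul]
    push_cast
    norm_num
    ring
  · convert! (summable_one_div_four_mul_add_pow 3 le_rfl).hasSum.neg using 2 with k
    rw [pow_succ, pow_mul]
    push_cast
    norm_num
    ring

lemma seven_mul_tsum_one_div_pnat_cube :
    7 * ∑' n : ℕ+, 1 / (n : ℝ) ^ 3 =
      8 * (∑' k : ℕ, 1 / (4 * (k : ℝ) + 1) ^ 3 + ∑' k : ℕ, 1 / (4 * (k : ℝ) + 3) ^ 3) := by
  rw [tsum_pnat_eq_tsum_succ (f := fun n : ℕ ↦ 1 / (n : ℝ) ^ 3)]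
  have hs : Summable fun n : ℕ ↦ 1 / ((n + 1 : ℕ) : ℝ) ^ 3 :=
    (summable_nat_add_iff 1).2 (Real.summable_one_div_nat_pow.2 (by norm_num : 1 < 3))
  have hodd : HasSum (fun j : ℕ ↦ 1 / (2 * (j : ℝ) + 1) ^ 3)
      (∑' k : ℕ, 1 / (4 * (k : ℝ) + 1) ^ 3 + ∑' k : ℕ, 1 / (4 * (k : ℝ) + 3) ^ 3) := by
    apply HasSum.even_add_odd
    · convert (summable_one_div_four_mul_add_pow 1 (by norm_num : 2 ≤ 3)).hasSum using 2 with k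
      push_cast
      ring
    · convert (summable_one_div_four_mul_add_pow 3 (by norm_num : 2 ≤ 3)).hasSum using 2 with k
      push_cast
      ring
  have hsplit := HasSum.even_add_odd (f := fun n : ℕ ↦ 1 / ((n + 1 : ℕ) : ℝ) ^ 3)
    (by convert hodd using 2 with k; push_cast; ring)
    (by
      refine (hs.hasSum.mul_left (1 / 8)).congr_fun fun k ↦ ?_
      push_cast
      field_simp
      ring)
  linarith [hsplit.tsum_eq]

lemma hasSum_one_div_succ_sub :
    HasSum (fun k : ℕ ↦ 1 / ((k : ℝ) + 1) - 2 / (4 * k + 3) - 2 / (4 * k + 5))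
      (2 - 3 * Real.log 2) := by
  have hneg (k : ℕ) : 0 ≤ -(1 / ((k : ℝ) + 1) - 2 / (4 * k + 3) - 2 / (4 * k + 5)) := by
    have h : -(1 / ((k : ℝ) + 1) - 2 / (4 * k + 3) - 2 / (4 * k + 5)) =
        1 / ((k + 1) * (4 * k + 3) * (4 * k + 5)) := by
      field_simp
      ring
    rw [h]
    positivity
  have hpartial (N : ℕ) :
      ∑ k ∈ Finset.range N, (1 / ((k : ℝ) + 1) - 2 / (4 * k + 3) - 2 / (4 * k + 5)) =
        harmonic N - 2 * harmonic (4 * N) + harmonic (2 * N) + 2 - 2 / (4 * N + 1) := by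
    induction N with
    | zero => norm_num
    | succ N ih =>
      rw [Finset.sum_range_succ, ih, show 4 * (N + 1) = 4 * N + 1 + 1 + 1 + 1 by ring,
        show 2 * (N + 1) = 2 * N + 1 + 1 by ring]
      simp only [harmonic_succ]
      push_cast
      field_simp
      ring
  have hmul {c : ℕ} (hc : 0 < c) : Tendsto (fun N : ℕ ↦ c * N) atTop atTop :=
    tendsto_id.const_mul_atTop' hc
  have hH := Real.tendsto_harmonic_sub_log
  have hfrac : Tendsto (fun N : ℕ ↦ 2 / (4 * (N : ℝ) + 1)) atTop (𝓝 0) :=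
    tendsto_const_nhds.div_atTop (tendsto_atTop_add_const_right _ _
      (tendsto_natCast_atTop_atTop.const_mul_atTop four_pos))
  have hlim := ((((hH.sub ((hH.comp (hmul four_pos)).const_mul 2)).add
    (hH.comp (hmul two_pos))).add_const (2 - 3 * Real.log 2)).sub hfrac)
  rw [← neg_neg (2 - 3 * Real.log 2)]
  refine .congr_fun ((hasSum_iff_tendsto_nat_of_nonneg hneg _).2 ?_).neg fun k ↦ by rw [neg_neg]
  simp only [Finset.sum_neg_distrib, hpartial]
  refine Tendsto.neg ?_
  convert hlim.congr' ?_ using 2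
  · ring
  · filter_upwards [eventually_gt_atTop 0] with N hN
    have hN' : (N : ℝ) ≠ 0 := by positivity
    have h4 : Real.log 4 = 2 * Real.log 2 := by
      rw [show (4 : ℝ) = 2 ^ 2 by norm_num, Real.log_pow, Nat.cast_ofNat]
    simp only [Function.comp_apply]
    push_cast
    rw [Real.log_mul (by norm_num) hN', Real.log_mul (by norm_num) hN', h4]
    ring

theorem sum_inv_n_mul_sixteen_sq_sub_one_pow_four :
    ∑' n : ℕ+, 1 / ((n : ℝ) * (16 * (n : ℝ) ^ 2 - 1) ^ 4) =
      (iteratedDeriv 3 digamma (3 / 4) - iteratedDeriv 3 digamma (1 / 4)) / 6144 +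
        (140 - 44 * catalan' - 96 * Real.log 2 -
          21 * ∑' n : ℕ+, 1 / (n : ℝ) ^ 3) / 32 := by
  have hz := seven_mul_tsum_one_div_pnat_cube
  rw [tsum_pnat_eq_tsum_succ (f := fun n : ℕ ↦ 1 / ((n : ℝ) * (16 * (n : ℝ) ^ 2 - 1) ^ 4)),
    iteratedDeriv_three_digamma_div_four three_pos, iteratedDeriv_three_digamma_div_four one_pos,
    catalan'_eq]
  have hB (m : ℕ) (hm : 2 ≤ m) := (summable_one_div_four_mul_add_pow 3 hm).hasSum
  have hA (m : ℕ) (hm : 2 ≤ m) := hasSum_one_div_four_mul_add_five_pow hm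
  have hsum := ((hasSum_one_div_succ_sub.add
    (((hB 2 (by norm_num)).sub (hA 2 (by norm_num))).mul_left (11 / 8))).sub
    (((hB 3 (by norm_num)).add (hA 3 (by norm_num))).mul_left (3 / 4))).add
    (((hB 4 (by norm_num)).sub (hA 4 (by norm_num))).mul_left (1 / 4))
  have hterm (k : ℕ) : 1 / (((k + 1 : ℕ) : ℝ) * (16 * ((k + 1 : ℕ) : ℝ) ^ 2 - 1) ^ 4) =
      1 / ((k : ℝ) + 1) - 2 / (4 * k + 3) - 2 / (4 * k + 5) +
        11 / 8 * (1 / (4 * (k : ℝ) + 3) ^ 2 - 1 / (4 * (k : ℝ) + 5) ^ 2) -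
        3 / 4 * (1 / (4 * (k : ℝ) + 3) ^ 3 + 1 / (4 * (k : ℝ) + 5) ^ 3) +
        1 / 4 * (1 / (4 * (k : ℝ) + 3) ^ 4 - 1 / (4 * (k : ℝ) + 5) ^ 4) := by
    push_cast
    rw [show 16 * ((k : ℝ) + 1) ^ 2 - 1 = (4 * k + 3) * (4 * k + 5) by ring]
    field_simp
    ring
  rw [tsum_congr hterm, hsum.tsum_eq]
  linarith
end
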